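/- arXiv:2403.02252 — 2 statements merged into one kernel-verified Lean document; each statement's English description precedes it below -/
import Mathlib

section
/- Let m ≥ 1 be an integer and let H : [0, 1] → ℝ be continuous on [0, 1] and differentiable on (0, 1), satisfying m·(1 − z)·H'(z) − H(z) = −(m + 1)·H(z^{m+1})·z^m·(1 − z)/(1 − z^{m+1}) for all z ∈ (0, 1). Then H(1)·ln(m + 1) = m·(H(1) − H(0)); in particular, if H(0) = m/(m + 1), then H(1) = m^2 / ((m + 1)(m − ln(m + 1))). -/
open Set Filter Topology in
/-- A function continuous on the half-line below `1` has a primitive there. -/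
theorem exists_hasDerivAt_of_continuousOn_Iio {f : ℝ → ℝ} (hf : ContinuousOn f (Iio 1)) :
    ∃ G : ℝ → ℝ, ∀ z < 1, HasDerivAt G (f z) z := by
  refine ⟨fun z => ∫ w in (0 : ℝ)..z, f w, fun z hz => ?_⟩
  refine intervalIntegral.integral_hasDerivAt_right ?_
    (hf.stronglyMeasurableAtFilter isOpen_Iio z hz) (hf.continuousAt (Iio_mem_nhds hz))
  refine (hf.mono fun x hx => ?_).intervalIntegrable
  exact lt_of_le_of_lt hx.2 (max_lt one_pos hz)

open Set Filter Topology in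
/-- A function continuous on `[0,1]`, divided by `1 - w`, has a primitive on `[0,1)`. -/
theorem exists_hasDerivAt_div_one_sub {H : ℝ → ℝ} (hH : ContinuousOn H (Icc 0 1)) :
    ∃ G : ℝ → ℝ, (∀ z < 1, ContinuousAt G z) ∧
      ∀ z ∈ Ioo (0 : ℝ) 1, HasDerivAt G (H z / (1 - z)) z := by
  have hext : Continuous (IccExtend (zero_le_one' ℝ) ((Icc (0 : ℝ) 1).domRestrict H)) :=
    hH.domRestrict.Icc_extend'
  obtain ⟨G, hG⟩ := exists_hasDerivAt_of_continuousOn_Iio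
    (f := fun w => IccExtend (zero_le_one' ℝ) ((Icc (0 : ℝ) 1).domRestrict H) w / (1 - w))
    (hext.continuousOn.div (by fun_prop) fun x hx => (sub_pos.2 hx).ne')
  refine ⟨G, fun z hz => (hG z hz).continuousAt, fun z hz => ?_⟩
  have h := hG z hz.2
  simp only [IccExtend_of_mem _ _ (Ioo_subset_Icc_self hz)] at h
  exact h

open Set in
/-- Integrating the functional equation over `(0,z)` and applying the mean value theorem. -/
theorem exists_mul_log_geom_sum_eq (m : ℕ) (hm : 1 ≤ m) (H : ℝ → ℝ)
    (hcont : ContinuousOn H (Icc 0 1))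
    (hdiff : ∀ z ∈ Ioo (0 : ℝ) 1, DifferentiableAt ℝ H z)
    (heq : ∀ z ∈ Ioo (0 : ℝ) 1,
      (m : ℝ) * (1 - z) * deriv H z - H z =
        -((m : ℝ) + 1) * H (z ^ (m + 1)) * z ^ m * (1 - z) / (1 - z ^ (m + 1)))
    {z : ℝ} (hz : z ∈ Ioo (0 : ℝ) 1) :
    ∃ ξ ∈ Ioo (z ^ (m + 1)) z,
      (m : ℝ) * (H z - H 0) = H ξ * Real.log (∑ i ∈ Finset.range (m + 1), z ^ i) := by
  obtain ⟨G, hGc, hG⟩ := exists_hasDerivAt_div_one_sub hcont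
  have hpow : ∀ x ∈ Ioo (0 : ℝ) 1, x ^ (m + 1) ∈ Ioo (0 : ℝ) 1 := fun x hx =>
    ⟨pow_pos hx.1 _, pow_lt_one₀ hx.1.le hx.2 (by omega)⟩
  have hprim : (m : ℝ) * (H z - H 0) = G z - G (z ^ (m + 1)) := by
    obtain ⟨c, hc, hslope⟩ := exists_hasDerivAt_eq_slope
      (fun x => m * H x - G x + G (x ^ (m + 1))) (fun _ => 0) hz.1
      (by
        refine ((continuousOn_const.mul (hcont.mono (Icc_subset_Icc_right hz.2.le))).sub
          fun x hx => (hGc x (hx.2.trans_lt hz.2)).continuousWithinAt).add fun x hx => ?_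
        refine ContinuousAt.continuousWithinAt ?_
        exact ContinuousAt.comp (f := fun x : ℝ => x ^ (m + 1))
          (hGc _ (pow_lt_one₀ hx.1 (hx.2.trans_lt hz.2) (by omega))) (by fun_prop))
      (by
        intro x hx
        have hx1 : x ∈ Ioo (0 : ℝ) 1 := ⟨hx.1, hx.2.trans hz.2⟩
        have h := (((hdiff x hx1).hasDerivAt.const_mul (m : ℝ)).sub (hG x hx1)).add
          (HasDerivAt.comp (h := fun x : ℝ => x ^ (m + 1)) x (hG _ (hpow x hx1))
            (hasDerivAt_pow (m + 1) x))
        refine h.congr_deriv ?_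
        have h1 : (1 : ℝ) - x ≠ 0 := (sub_pos.2 hx1.2).ne'
        have h2 : (1 : ℝ) - x ^ (m + 1) ≠ 0 := (sub_pos.2 (hpow x hx1).2).ne'
        have e := heq x hx1
        rw [eq_div_iff h2] at e
        rw [Nat.add_sub_cancel]
        push_cast
        rw [← mul_right_inj' (mul_ne_zero h1 h2), mul_zero]
        field_simp
        linear_combination e)
    rw [eq_div_iff (by linarith [hz.1]), zero_mul] at hslope
    simp only [zero_pow (Nat.succ_ne_zero m)] at hslope
    linarith
  have hlt : z ^ (m + 1) < z := pow_lt_self_of_lt_one₀ hz.1 hz.2 (by omega)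
  have hIcc : ∀ x ∈ Icc (z ^ (m + 1)) z, x < 1 := fun x hx => hx.2.trans_lt hz.2
  have hL : ∀ x < 1, HasDerivAt (fun y : ℝ => -Real.log (1 - y)) (1 / (1 - x)) x := by
    intro x hx
    refine (((hasDerivAt_id x).const_sub 1).log (sub_pos.2 hx).ne').neg.congr_deriv ?_
    simp only [id, neg_div, neg_neg]
  obtain ⟨ξ, hξ, hratio⟩ := exists_ratio_hasDerivAt_eq_ratio_slope G (fun x => H x / (1 - x)) hlt
    (fun x hx => (hGc x (hIcc x hx)).continuousWithinAt)
    (fun x hx => hG x ⟨(hpow z hz).1.trans hx.1, hx.2.trans hz.2⟩)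
    (fun y => -Real.log (1 - y)) (fun x => 1 / (1 - x))
    (fun x hx => (hL x (hIcc x hx)).continuousAt.continuousWithinAt)
    (fun x hx => hL x (hx.2.trans hz.2))
  refine ⟨ξ, hξ, ?_⟩
  have h1 : (1 : ℝ) - ξ ≠ 0 := (sub_pos.2 (hξ.2.trans hz.2)).ne'
  have hgeom : Real.log (∑ i ∈ Finset.range (m + 1), z ^ i) =
      -Real.log (1 - z) - -Real.log (1 - z ^ (m + 1)) := by
    rw [← mul_neg_geom_sum, Real.log_mul (sub_pos.2 hz.2).ne'
      (geom_sum_pos hz.1.le (by omega)).ne']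
    ring
  rw [hprim, hgeom]
  field_simp at hratio
  linarith

open Filter Topology in

/-- Example 5, identities (312)–(313): let `m ≥ 1` and let
`H : [0,1] → ℝ` be continuous on `[0,1]`, differentiable on `(0,1)`, and satisfy
`m(1−z)H'(z) − H(z) = −(m+1)·H(z^{m+1})·z^m·(1−z)/(1−z^{m+1})` on `(0,1)`.  Then
`H(1)·ln(m+1) = m·(H(1) − H(0))`; in particular, if `H(0) = m/(m+1)` then
`H(1) = m²/((m+1)(m − ln(m+1)))`. -/
theorem H_boundary_identity (m : ℕ) (hm : 1 ≤ m) (H : ℝ → ℝ)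
    (hcont : ContinuousOn H (Set.Icc 0 1))
    (hdiff : ∀ z ∈ Set.Ioo (0 : ℝ) 1, DifferentiableAt ℝ H z)
    (heq : ∀ z ∈ Set.Ioo (0 : ℝ) 1,
      (m : ℝ) * (1 - z) * deriv H z - H z =
        -((m : ℝ) + 1) * H (z ^ (m + 1)) * z ^ m * (1 - z) / (1 - z ^ (m + 1))) :
    H 1 * Real.log ((m : ℝ) + 1) = (m : ℝ) * (H 1 - H 0) ∧
    (H 0 = (m : ℝ) / ((m : ℝ) + 1) →
      H 1 = (m : ℝ) ^ 2 / (((m : ℝ) + 1) * ((m : ℝ) - Real.log ((m : ℝ) + 1)))) := by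
  have hpos : (0 : ℝ) < m := by exact_mod_cast hm
  have hmain : H 1 * Real.log ((m : ℝ) + 1) = (m : ℝ) * (H 1 - H 0) := by
    have hex : ∀ z : ℝ, ∃ ξ : ℝ, z ∈ Set.Ioo (0 : ℝ) 1 → ξ ∈ Set.Ioo (z ^ (m + 1)) z ∧
        (m : ℝ) * (H z - H 0) = H ξ * Real.log (∑ i ∈ Finset.range (m + 1), z ^ i) := by
      intro z
      by_cases hz : z ∈ Set.Ioo (0 : ℝ) 1
      · obtain ⟨ξ, hξ⟩ := exists_mul_log_geom_sum_eq m hm H hcont hdiff heq hz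
        exact ⟨ξ, fun _ => hξ⟩
      · exact ⟨0, fun h => absurd h hz⟩
    choose ξ hξ using hex
    have hev : ∀ᶠ z : ℝ in 𝓝[<] 1, z ∈ Set.Ioo (0 : ℝ) 1 := Ioo_mem_nhdsLT one_pos
    have hid : Tendsto (fun z : ℝ => z) (𝓝[<] 1) (𝓝 1) := tendsto_id.mono_left nhdsWithin_le_nhds
    have hξ1 : Tendsto ξ (𝓝[<] 1) (𝓝 1) := by
      refine tendsto_of_tendsto_of_tendsto_of_le_of_le' (by simpa using hid.pow (m + 1)) hid ?_ ?_
      · filter_upwards [hev] with z hz using (hξ z hz).1.1.le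
      · filter_upwards [hev] with z hz using (hξ z hz).1.2.le
    have hH1 : Tendsto H (𝓝[Set.Icc 0 1] 1) (𝓝 (H 1)) := hcont 1 (by simp)
    have hHz : Tendsto H (𝓝[<] 1) (𝓝 (H 1)) := hH1.comp <| tendsto_nhdsWithin_iff.2
      ⟨hid, hev.mono fun z hz => Set.Ioo_subset_Icc_self hz⟩
    have hHξ : Tendsto (fun z => H (ξ z)) (𝓝[<] 1) (𝓝 (H 1)) := by
      refine hH1.comp (tendsto_nhdsWithin_iff.2 ⟨hξ1, ?_⟩)
      filter_upwards [hev] with z hz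
      obtain ⟨h1, h2⟩ := (hξ z hz).1
      exact ⟨(pow_pos hz.1 _).le.trans h1.le, h2.le.trans hz.2.le⟩
    have hsum : Tendsto (fun z : ℝ => ∑ i ∈ Finset.range (m + 1), z ^ i) (𝓝[<] 1)
        (𝓝 ((m : ℝ) + 1)) := by
      simpa using tendsto_finsetSum (Finset.range (m + 1)) fun i _ => hid.pow i
    have hright := hHξ.mul (hsum.log (by positivity))
    have hleft := (hHz.sub_const (H 0)).const_mul (m : ℝ)
    refine tendsto_nhds_unique hright (hleft.congr' ?_)
    filter_upwards [hev] with z hz using (hξ z hz).2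
  refine ⟨hmain, fun h0 => ?_⟩
  have hlog : 0 < (m : ℝ) - Real.log ((m : ℝ) + 1) := by
    linarith [Real.log_lt_sub_one_of_pos (x := (m : ℝ) + 1) (by positivity) (by linarith)]
  rw [h0] at hmain
  rw [eq_div_iff (by positivity)]
  field_simp at hmain
  linear_combination -hmain
end

section
/- Let m ≥ 1 be an integer and let Φ(z) = Σ_{n=1}^∞ φ_n z^n be analytic on the open unit disc with all φ_n ≥ 0 and φ_1 = 1, satisfying ∫_0^1 Φ(z·(r + (1 − r)z)^m) dr = Φ(z)/(m + 1) for all z ∈ (0, 1). Then lim_{n→∞} φ_n / n = m^2 / ((m + 1)(m − ln(m + 1))). -/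
open Filter

theorem coeff_eq_zero_of_hasSum_zero_on_Ioo {a : ℕ → ℝ}
    (hs : ∀ z : ℝ, |z| < 1 → Summable fun n => a n * z ^ n)
    (h0 : ∀ z ∈ Set.Ioo (0 : ℝ) 1, HasSum (fun n => a n * z ^ n) 0) (n : ℕ) : a n = 0 := by
  have hball : ∀ᶠ z : ℝ in nhds 0, |z| < 1 := by
    have := Metric.ball_mem_nhds (0 : ℝ) one_pos
    filter_upwards [this] with z hz
    simpa using hz
  have hf : HasFPowerSeriesAt (fun z : ℝ => ∑' n, a n * z ^ n)
      (FormalMultilinearSeries.ofScalars ℝ a) 0 := by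
    rw [hasFPowerSeriesAt_iff]
    filter_upwards [hball] with z hz
    simpa [FormalMultilinearSeries.coeff_ofScalars, mul_comm] using (hs z hz).hasSum
  have hfreq : ∃ᶠ z in nhdsWithin (0 : ℝ) {0}ᶜ, (∑' n, a n * z ^ n) = 0 := by
    have hev : ∀ᶠ z in nhdsWithin (0 : ℝ) (Set.Ioi 0), (∑' n, a n * z ^ n) = 0 := by
      filter_upwards [Ioo_mem_nhdsGT (zero_lt_one' ℝ)] with z hz
      exact (h0 z hz).tsum_eq
    exact hev.frequently.filter_mono (nhdsWithin_mono _ fun x hx => ne_of_gt hx)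
  have hzero := (hf.analyticAt.frequently_zero_iff_eventually_zero).1 hfreq
  have hp := (hf.congr hzero).eq_zero
  rw [← FormalMultilinearSeries.coeff_ofScalars (𝕜 := ℝ) (p := a) (n := n), hp]
  simp [FormalMultilinearSeries.coeff]

theorem integral_convexComb_pow {z : ℝ} (hz : z < 1) (p : ℕ) :
    ∫ r in (0 : ℝ)..1, (r + (1 - r) * z) ^ p = (1 - z ^ (p + 1)) / (((p : ℝ) + 1) * (1 - z)) := by
  have h1 : 1 - z ≠ 0 := by linarith
  have h := intervalIntegral.integral_comp_mul_add (a := 0) (b := 1) (fun x : ℝ => x ^ p) h1 z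
  have hfun : (fun r : ℝ => (r + (1 - r) * z) ^ p) = fun r => ((1 - z) * r + z) ^ p := by
    ext r; congr 1; ring
  rw [hfun, h]
  simp only [mul_zero, zero_add, mul_one, sub_add_cancel, integral_pow, one_pow, smul_eq_mul]
  field_simp

theorem hasSum_integral_powerSeries_comp {m : ℕ} {φ : ℕ → ℝ} (hφ : ∀ n, 0 ≤ φ n) {Φ : ℝ → ℝ}
    (hsum : ∀ z : ℝ, |z| < 1 → HasSum (fun n : ℕ => φ n * z ^ n) (Φ z))
    {z : ℝ} (hz : z ∈ Set.Ioo (0 : ℝ) 1) :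
    HasSum (fun k : ℕ => φ k * z ^ k * ((1 - z ^ (m * k + 1)) / (((m : ℝ) * k + 1) * (1 - z))))
      (∫ r in (0 : ℝ)..1, Φ (z * (r + (1 - r) * z) ^ m)) := by
  obtain ⟨hz0, hz1⟩ := hz
  have habs : |z| < 1 := by rw [abs_of_pos hz0]; exact hz1
  have hbd : ∀ t ∈ Set.uIoc (0 : ℝ) 1, 0 ≤ t + (1 - t) * z ∧ t + (1 - t) * z ≤ 1 := by
    intro t ht
    rw [Set.uIoc_of_le zero_le_one] at ht
    constructor <;> nlinarith [ht.1, ht.2]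
  have key := intervalIntegral.hasSum_integral_of_dominated_convergence (a := 0) (b := 1)
    (μ := MeasureTheory.volume)
    (F := fun (k : ℕ) (t : ℝ) => φ k * z ^ k * (t + (1 - t) * z) ^ (m * k))
    (f := fun r => Φ (z * (r + (1 - r) * z) ^ m)) (fun k _ => φ k * z ^ k)
    (fun k => (by fun_prop : Continuous _).aestronglyMeasurable)
    (fun k => Eventually.of_forall fun t ht => by
      obtain ⟨h0, h1⟩ := hbd t ht
      have hc : 0 ≤ φ k * z ^ k := mul_nonneg (hφ k) (pow_nonneg hz0.le k)
      rw [Real.norm_of_nonneg (by positivity)]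
      exact mul_le_of_le_one_right hc (pow_le_one₀ h0 h1))
    (Eventually.of_forall fun t _ => (hsum z habs).summable)
    (by simp)
    (Eventually.of_forall fun t ht => by
      obtain ⟨h0, h1⟩ := hbd t ht
      have hw : |z * (t + (1 - t) * z) ^ m| < 1 := by
        rw [abs_of_nonneg (by positivity)]
        exact (mul_le_of_le_one_right hz0.le (pow_le_one₀ h0 h1)).trans_lt hz1
      have := hsum _ hw
      simp only [mul_pow, ← pow_mul, ← mul_assoc] at this
      exact this)
  refine key.congr_fun fun k => ?_
  rw [intervalIntegral.integral_const_mul, integral_convexComb_pow hz1]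
  push_cast
  rfl

theorem coeff_recurrence {m : ℕ} {φ : ℕ → ℝ} (hφ : ∀ n, 0 ≤ φ n) (hφ0 : φ 0 = 0) {Φ : ℝ → ℝ}
    (hsum : ∀ z : ℝ, |z| < 1 → HasSum (fun n : ℕ => φ n * z ^ n) (Φ z))
    (heq : ∀ z ∈ Set.Ioo (0 : ℝ) 1,
      ∫ r in (0 : ℝ)..1, Φ (z * (r + (1 - r) * z) ^ m) = Φ z / ((m : ℝ) + 1))
    {ψ : ℕ → ℝ} (hψ : ∀ n, ψ n = φ n / ((m : ℝ) * n + 1)) (n : ℕ) :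
    (m : ℝ) * n * ψ (n + 1) =
      (m * n + 1) * ψ n - (m + 1) * (if m + 1 ∣ n then ψ (n / (m + 1)) else 0) := by
  have hψnn : ∀ k, 0 ≤ ψ k := fun k => by rw [hψ]; have := hφ k; positivity
  have hψle : ∀ k, ψ k ≤ φ k := fun k => by
    rw [hψ]
    exact div_le_self (hφ k) (le_add_of_nonneg_left (by positivity))
  have hψ0 : ψ 0 = 0 := by simp [hψ, hφ0]
  set c : ℕ → ℝ := fun n => if m + 1 ∣ n then ψ (n / (m + 1)) else 0 with hc
  have hψs : ∀ z : ℝ, |z| < 1 → Summable fun k => ψ k * z ^ k := fun z hz => by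
    refine Summable.of_norm_bounded (hsum |z| (by simpa using hz)).summable fun k => ?_
    rw [norm_mul, norm_pow, Real.norm_of_nonneg (hψnn k), Real.norm_eq_abs]
    exact mul_le_mul_of_nonneg_right (hψle k) (by positivity)
  set A : ℝ → ℝ := fun z => ∑' k, ψ k * z ^ k with hA
  have hψA : ∀ z : ℝ, |z| < 1 → HasSum (fun k => ψ k * z ^ k) (A z) :=
    fun z hz => (hψs z hz).hasSum
  have hψC : ∀ z : ℝ, |z| < 1 → HasSum (fun k => ψ k * z ^ ((m + 1) * k)) (A (z ^ (m + 1))) :=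
    fun z hz => by
    have : |z ^ (m + 1)| < 1 := by
      rw [abs_pow]; exact pow_lt_one₀ (abs_nonneg z) hz (by omega)
    simpa only [← pow_mul] using hψA _ this
  have hcC : ∀ z : ℝ, |z| < 1 → HasSum (fun n => c n * z ^ n) (A (z ^ (m + 1))) := fun z hz => by
    have hinj : Function.Injective fun k : ℕ => (m + 1) * k :=
      fun a b h => Nat.eq_of_mul_eq_mul_left (Nat.succ_pos m) h
    refine (hinj.hasSum_iff ?_).1 ?_
    · intro x hx
      have : ¬ m + 1 ∣ x := fun ⟨k, hk⟩ => hx ⟨k, hk.symm⟩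
      simp [hc, this]
    · convert hψC z hz using 2 with k
      simp [hc]
  have hW : ∀ z : ℝ, |z| < 1 → z ≠ 0 →
      HasSum (fun n => ((ψ (n + 1) - φ (n + 1) / (m + 1)) - (c n - φ n / (m + 1))) * z ^ n)
        ((A z - Φ z / (m + 1)) / z - (A (z ^ (m + 1)) - Φ z / (m + 1))) := fun z hz hz0 => by
    have h1 := (hψA z hz).sub ((hsum z hz).div_const ((m : ℝ) + 1))
    have h2 := ((hasSum_nat_add_iff' 1).2 h1).div_const z
    have h3 := (hcC z hz).sub ((hsum z hz).div_const ((m : ℝ) + 1))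
    have h4 := h2.sub h3
    simp only [Finset.sum_range_one, hψ0, hφ0, zero_mul, zero_div, sub_zero] at h4
    refine h4.congr_fun fun k => ?_
    field_simp
    ring
  have hzero := coeff_eq_zero_of_hasSum_zero_on_Ioo
    (a := fun n => (ψ (n + 1) - φ (n + 1) / (m + 1)) - (c n - φ n / (m + 1)))
    (fun z hz => by
      rcases eq_or_ne z 0 with rfl | hz0
      · refine summable_of_ne_finset_zero (s := {0}) fun k hk => ?_
        have : k ≠ 0 := by simpa using hk
        simp [this]
      · exact (hW z hz hz0).summable)
    (fun z hz => by
      have habs : |z| < 1 := by rw [abs_of_pos hz.1]; exact hz.2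
      have h1z : 1 - z ≠ 0 := by linarith [hz.2]
      have h1 := (hasSum_integral_powerSeries_comp (m := m) hφ hsum hz).mul_left (1 - z)
      rw [heq z hz] at h1
      have h2 := (hψA z habs).sub ((hψC z habs).mul_left z)
      have h3 : (1 - z) * (Φ z / (m + 1)) = A z - z * A (z ^ (m + 1)) := by
        refine h1.unique ?_
        refine h2.congr_fun fun k => ?_
        rw [hψ]
        have : (m : ℝ) * k + 1 ≠ 0 := by positivity
        field_simp
        ring
      have h4 := hW z habs hz.1.ne'
      convert h4 using 1
      have := hz.1.ne'
      rw [eq_comm, sub_eq_zero, div_eq_iff this]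
      linear_combination -h3)
    n
  have e1 : ∀ k : ℕ, φ k = (m * k + 1) * ψ k := fun k => by
    have : (m : ℝ) * k + 1 ≠ 0 := by positivity
    rw [hψ]; field_simp
  rw [e1 (n + 1), e1 n] at hzero
  have hm1 : (m : ℝ) + 1 ≠ 0 := by positivity
  push_cast at hzero
  field_simp at hzero
  change _ = _ - (m + 1) * c n
  linear_combination -hzero

theorem windowed_sum_of_recurrence {m : ℕ} {ψ : ℕ → ℝ}
    (hrec : ∀ n : ℕ, (m : ℝ) * n * ψ (n + 1) =
      (m * n + 1) * ψ n - (m + 1) * (if m + 1 ∣ n then ψ (n / (m + 1)) else 0)) (n : ℕ) :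
    (m : ℝ) * ψ (n + 1) = m * ψ 1 + ∑ j ∈ Finset.Ioc (n / (m + 1)) n, ψ j / j := by
  have hT : ∀ n : ℕ, (m : ℝ) * ψ (n + 1) = m * ψ 1 + (∑ j ∈ Finset.Ioc 0 n, ψ j / j -
      ∑ j ∈ Finset.Ioc 0 (n / (m + 1)), ψ j / j) := by
    intro n
    induction n with
    | zero => simp
    | succ n ih =>
      have h := hrec (n + 1)
      have hn : ((n + 1 : ℕ) : ℝ) ≠ 0 := by positivity
      rw [Finset.sum_Ioc_succ_top (Nat.zero_le n), Nat.succ_div]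
      split_ifs at h ⊢ with hd
      · have hq : (n + 1) / (m + 1) = n / (m + 1) + 1 := by rw [Nat.succ_div, if_pos hd]
        rw [Finset.sum_Ioc_succ_top (Nat.zero_le _)]
        rw [hq] at h
        have hk : ((n + 1 : ℕ) : ℝ) = (m + 1) * ((n / (m + 1) + 1 : ℕ) : ℝ) := by
          rw [← hq]; exact_mod_cast (Nat.mul_div_cancel' hd).symm
        have hk0 : ((n / (m + 1) + 1 : ℕ) : ℝ) ≠ 0 := by positivity
        generalize n / (m + 1) + 1 = k at *
        have e : (m : ℝ) * ψ (n + 1 + 1) =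
            m * ψ (n + 1) + ψ (n + 1) / (n + 1 : ℕ) - ψ k / k := by
          apply mul_left_cancel₀ hn
          have h1 : ((n + 1 : ℕ) : ℝ) * (ψ (n + 1) / (n + 1 : ℕ)) = ψ (n + 1) :=
            mul_div_cancel₀ _ hn
          have h2 : ((n + 1 : ℕ) : ℝ) * (ψ k / k) = (m + 1) * ψ k := by
            rw [hk]; field_simp
          linear_combination h - h1 + h2
        linear_combination e + ih
      · have e : (m : ℝ) * ψ (n + 1 + 1) = m * ψ (n + 1) + ψ (n + 1) / (n + 1 : ℕ) := by
          apply mul_left_cancel₀ hn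
          have h1 : ((n + 1 : ℕ) : ℝ) * (ψ (n + 1) / (n + 1 : ℕ)) = ψ (n + 1) :=
            mul_div_cancel₀ _ hn
          linear_combination h - h1
        rw [add_zero]
        linear_combination e + ih
  rw [hT n, ← Finset.sum_Ioc_consecutive _ (Nat.zero_le _) (Nat.div_le_self n (m + 1))]
  ring

theorem tendsto_sum_Ioc_div_inv (d : ℕ) (hd : 0 < d) :
    Tendsto (fun n : ℕ => ∑ j ∈ Finset.Ioc (n / d) n, (1 : ℝ) / j) atTop
      (nhds (Real.log d)) := by
  have hdiv : Tendsto (fun n : ℕ => n / d) atTop atTop := Nat.tendsto_div_const_atTop hd.ne'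
  have hH := Real.tendsto_harmonic_sub_log
  have hd' : (0 : ℝ) < d := by exact_mod_cast hd
  have hratio : Tendsto (fun n : ℕ => (n : ℝ) / (n / d : ℕ)) atTop (nhds (d : ℝ)) := by
    have h := (tendsto_nat_floor_mul_div_atTop (R := ℝ) (a := (d : ℝ)⁻¹)
      (by positivity)).comp tendsto_natCast_atTop_atTop
    have h' := h.inv₀ (by positivity)
    rw [inv_inv] at h'
    refine h'.congr fun n => ?_
    simp only [Function.comp, inv_div]
    rw [inv_mul_eq_div, Nat.floor_div_eq_div]
  have hlog := hratio.log hd'.ne'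
  have hlim := (hH.sub (hH.comp hdiv)).add hlog
  rw [sub_self, zero_add] at hlim
  refine hlim.congr' ?_
  filter_upwards [hdiv.eventually_gt_atTop 0, eventually_gt_atTop 0] with n hk hn
  have hsum := Finset.sum_Ioc_consecutive (fun j : ℕ => (1 : ℝ) / j) (Nat.zero_le _)
    (Nat.div_le_self n d)
  have hh : ∀ k : ℕ, ((harmonic k : ℚ) : ℝ) = ∑ j ∈ Finset.Ioc 0 k, (1 : ℝ) / j := by
    intro k
    rw [harmonic_eq_sum_Icc]
    push_cast
    simp only [one_div]
    rfl
  have hn' : (n : ℝ) ≠ 0 := by positivity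
  have hk' : ((n / d : ℕ) : ℝ) ≠ 0 := by positivity
  simp only [Function.comp, hh]
  rw [Real.log_div hn' hk']
  linarith

theorem tendsto_zero_of_window_contraction {x δ : ℕ → ℝ} {k : ℕ → ℕ} {q : ℝ}
    (hx : ∀ n, 0 ≤ x n) (hk : Tendsto k atTop atTop) (hq0 : 0 ≤ q) (hq1 : q < 1)
    (hδ : Tendsto δ atTop (nhds 0))
    (h : ∀ᶠ n in atTop, ∀ B : ℝ, 0 ≤ B → (∀ j ∈ Finset.Ioc (k n) n, x j ≤ B) →
      x (n + 1) ≤ q * B + δ n) :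
    Tendsto x atTop (nhds 0) := by
  have hδ' : ∀ ε > 0, ∀ᶠ n in atTop, δ n ≤ ε := fun ε hε => hδ.eventually_le_const hε
  obtain ⟨B, hB0, hB⟩ : ∃ B : ℝ, 0 < B ∧ ∀ n, x n ≤ B := by
    obtain ⟨N, hN⟩ := eventually_atTop.1 (h.and (hδ' (1 - q) (by linarith)))
    have hS : 0 ≤ ∑ j ∈ Finset.range (N + 1), x j := Finset.sum_nonneg fun j _ => hx j
    refine ⟨1 + ∑ j ∈ Finset.range (N + 1), x j, by linarith, fun n => ?_⟩
    induction n using Nat.strong_induction_on with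
    | _ n ih =>
      rcases lt_or_ge n (N + 1) with hn | hn
      · have := Finset.single_le_sum (fun j _ => hx j) (Finset.mem_range.2 hn)
        linarith
      · obtain ⟨p, rfl⟩ : ∃ p, n = p + 1 := ⟨n - 1, by omega⟩
        obtain ⟨h1, h2⟩ := hN p (by omega)
        have := h1 _ (by linarith) fun j hj => ih j (by have := (Finset.mem_Ioc.1 hj).2; omega)
        nlinarith
  have hiter : ∀ i : ℕ, ∀ᶠ n in atTop, x n ≤ ((1 + q) / 2) ^ i * B := by
    intro i
    induction i with
    | zero => simpa using Eventually.of_forall (f := atTop) hB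
    | succ i ih =>
      have hpos : 0 < ((1 + q) / 2) ^ i * B := by positivity
      obtain ⟨N, hN⟩ := eventually_atTop.1 ih
      rw [← map_add_atTop_eq_nat 1, eventually_map]
      filter_upwards [h, hk.eventually_ge_atTop N,
        hδ' ((1 - q) / 2 * (((1 + q) / 2) ^ i * B))
          (mul_pos (by linarith) hpos)] with n h1 h2 h3
      have := h1 _ hpos.le fun j hj => hN j (h2.trans (Finset.mem_Ioc.1 hj).1.le)
      rw [pow_succ]
      linarith
  have hgeo : Tendsto (fun i : ℕ => ((1 + q) / 2) ^ i * B) atTop (nhds 0) := by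
    simpa using (tendsto_pow_atTop_nhds_zero_of_lt_one (r := (1 + q) / 2) (by linarith)
      (by linarith)).mul_const B
  rw [tendsto_order]
  refine ⟨fun a ha => Eventually.of_forall fun n => ha.trans_le (hx n), fun a ha => ?_⟩
  obtain ⟨i, hi⟩ := (hgeo.eventually_lt_const ha).exists
  filter_upwards [hiter i] with n hn using hn.trans_lt hi

theorem tendsto_of_windowed_sum {m : ℕ} (hm : 1 ≤ m) {ψ : ℕ → ℝ} {c : ℝ}
    (h : ∀ n : ℕ, (m : ℝ) * ψ (n + 1) = m * c + ∑ j ∈ Finset.Ioc (n / (m + 1)) n, ψ j / j) :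
    Tendsto ψ atTop (nhds (m * c / (m - Real.log (m + 1)))) := by
  have hm0 : (0 : ℝ) < m := by exact_mod_cast hm
  have hlog : Real.log ((m : ℝ) + 1) < m := by
    have := Real.log_lt_sub_one_of_pos (x := (m : ℝ) + 1) (by positivity) (by linarith)
    linarith
  have hlog0 : 0 ≤ Real.log ((m : ℝ) + 1) := Real.log_nonneg (by linarith)
  set l := Real.log ((m : ℝ) + 1) with hl
  set L : ℝ := m * c / (m - l) with hL
  have hLeq : (m : ℝ) * L = m * c + L * l := by
    have : (m : ℝ) - l ≠ 0 := by linarith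
    rw [hL]; field_simp; ring
  have hh : Tendsto (fun n : ℕ => ∑ j ∈ Finset.Ioc (n / (m + 1)) n, (1 : ℝ) / j) atTop (nhds l) := by
    simpa using tendsto_sum_Ioc_div_inv (m + 1) (Nat.succ_pos m)
  set η : ℕ → ℝ := fun n => ∑ j ∈ Finset.Ioc (n / (m + 1)) n, (1 : ℝ) / j with hη
  have hqm : (l + m) / 2 / m < 1 := by rw [div_lt_one hm0]; linarith
  have hδ : Tendsto (fun n => |L * (η n - l)| / m) atTop (nhds 0) := by
    have : Tendsto (fun n => |L * (η n - l)| / m) atTop (nhds (|L * (l - l)| / m)) :=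
      (((hh.sub_const l).const_mul L).abs).div_const _
    simpa using this
  have hx := tendsto_zero_of_window_contraction (x := fun n => |ψ n - L|)
    (k := fun n => n / (m + 1)) (q := (l + m) / 2 / m) (fun n => abs_nonneg _)
    (Nat.tendsto_div_const_atTop (Nat.succ_ne_zero m)) (by positivity) hqm hδ (by
      filter_upwards [hh.eventually_le_const (show l < (l + m) / 2 by linarith)] with n hn B hB hj
      have e : (m : ℝ) * (ψ (n + 1) - L) =
          ∑ j ∈ Finset.Ioc (n / (m + 1)) n, (ψ j - L) * (1 / j) + L * (η n - l) := by
        have : ∑ j ∈ Finset.Ioc (n / (m + 1)) n, (ψ j - L) * (1 / (j : ℝ)) =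
            ∑ j ∈ Finset.Ioc (n / (m + 1)) n, ψ j / j - L * η n := by
          rw [hη, Finset.mul_sum, ← Finset.sum_sub_distrib]
          exact Finset.sum_congr rfl fun j _ => by ring
        rw [this]
        linear_combination h n - hLeq
      have b1 : |∑ j ∈ Finset.Ioc (n / (m + 1)) n, (ψ j - L) * (1 / (j : ℝ))| ≤ B * η n := by
        refine (Finset.abs_sum_le_sum_abs _ _).trans ?_
        rw [hη, Finset.mul_sum]
        refine Finset.sum_le_sum fun j hjm => ?_
        rw [abs_mul, abs_of_nonneg (by positivity : (0 : ℝ) ≤ 1 / j)]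
        exact mul_le_mul_of_nonneg_right (hj j hjm) (by positivity)
      have b2 : (m : ℝ) * |ψ (n + 1) - L| ≤ B * ((l + m) / 2) + |L * (η n - l)| := by
        rw [← abs_of_pos hm0, ← abs_mul, abs_of_pos hm0, e]
        exact (abs_add_le _ _).trans
          (add_le_add_left (b1.trans (mul_le_mul_of_nonneg_left hn hB)) _)
      rw [← mul_le_mul_iff_right₀ hm0]
      refine b2.trans_eq ?_
      field_simp)
  rw [tendsto_iff_norm_sub_tendsto_zero]
  exact hx


/-- Theorem 2, leading asymptotics for the binomial kernel: let `m ≥ 1`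
and let `Φ(z) = Σ_{n≥1} φ_n z^n` be (the real restriction of) an analytic function on
the open unit disc with all `φ_n ≥ 0` and `φ_1 = 1`, satisfying the Schröder-type
equation `∫_0^1 Φ(z(r + (1−r)z)^m) dr = Φ(z)/(m+1)` for all `z ∈ (0,1)`.  Then
`φ_n/n → m²/((m+1)(m − ln(m+1)))` as `n → ∞`. -/
theorem binomial_kernel_leading_asymptotics (m : ℕ) (hm : 1 ≤ m)
    (φ : ℕ → ℝ) (hφnn : ∀ n, 0 ≤ φ n) (hφ0 : φ 0 = 0) (hφ1 : φ 1 = 1) (Φ : ℝ → ℝ)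
    (hsum : ∀ z : ℝ, |z| < 1 → HasSum (fun n : ℕ => φ n * z ^ n) (Φ z))
    (heq : ∀ z ∈ Set.Ioo (0 : ℝ) 1,
      ∫ r in (0 : ℝ)..1, Φ (z * (r + (1 - r) * z) ^ m) = Φ z / ((m : ℝ) + 1)) :
    Tendsto (fun n : ℕ => φ n / (n : ℝ)) atTop
      (nhds ((m : ℝ) ^ 2 / (((m : ℝ) + 1) * ((m : ℝ) - Real.log ((m : ℝ) + 1))))) := by
  have hm0 : (0 : ℝ) < m := by exact_mod_cast hm
  let ψ : ℕ → ℝ := fun n => φ n / ((m : ℝ) * n + 1)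
  have hrec := coeff_recurrence hφnn hφ0 hsum heq (ψ := ψ) fun _ => rfl
  have hwin := windowed_sum_of_recurrence (m := m) hrec
  have hψ := tendsto_of_windowed_sum hm hwin
  have hlin : Tendsto (fun n : ℕ => (m : ℝ) + 1 / n) atTop (nhds m) := by
    simpa using tendsto_one_div_atTop_nhds_zero_nat.const_add (m : ℝ)
  have hlim := hψ.mul hlin
  have hval : (m : ℝ) * ψ 1 / (m - Real.log (m + 1)) * m =
      (m : ℝ) ^ 2 / (((m : ℝ) + 1) * ((m : ℝ) - Real.log ((m : ℝ) + 1))) := by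
    simp only [ψ, hφ1, Nat.cast_one, mul_one]
    rw [← div_div]
    ring
  rw [hval] at hlim
  refine hlim.congr' ?_
  filter_upwards [eventually_gt_atTop 0] with n hn
  have hn' : (n : ℝ) ≠ 0 := by positivity
  have : (m : ℝ) * n + 1 ≠ 0 := by positivity
  simp only [ψ]
  field_simp
end
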